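/- Let N₁, N₂ ∈ ℝ⁸ be orthonormal vectors, let V = {x ∈ ℝ⁸ : ⟨x,N₁⟩ = ⟨x,N₂⟩ = 0} be their orthogonal complement, and define J : V → ℝ⁸ by Jx = P(N₁,N₂,x). Then: Jx ∈ V for every x ∈ V, J(Jx) = −x for every x ∈ V, and ⟨Jx, Jy⟩ = ⟨x,y⟩ for all x, y ∈ V. In other words, J is an orthogonal complex structure on the 6-dimensional subspace V, compatible with the induced inner product. -/

import Mathlib

open scoped BigOperators RealInnerProductSpace

noncomputable section

abbrev Form (n p : ℕ) := (Fin p → EuclideanSpace ℝ (Fin n)) → ℝ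

namespace Form

/-- Wedge product of forms (shuffle convention; full antisymmetrization divided by p!q!). -/
def wedge {n p q : ℕ} (α : Form n p) (β : Form n q) : Form n (p + q) :=
  fun x =>
    (((p.factorial * q.factorial : ℕ) : ℝ))⁻¹ *
      ∑ σ : Equiv.Perm (Fin (p + q)),
        ((Equiv.Perm.sign σ : ℤ) : ℝ) *
          (α fun i => x (σ (Fin.castAdd q i))) * (β fun j => x (σ (Fin.natAdd p j)))

/-- Inner product of `p`-forms. -/
def inner' {n p : ℕ} (α β : Form n p) : ℝ :=
  ((p.factorial : ℕ) : ℝ)⁻¹ *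
    ∑ f : Fin p → Fin n,
      (α fun k => EuclideanSpace.single (f k) 1) * (β fun k => EuclideanSpace.single (f k) 1)

/-- Interior product of a vector and a form. -/
def iprod {n p : ℕ} (v : EuclideanSpace ℝ (Fin n)) (α : Form n (p + 1)) : Form n p :=
  fun x => α (Fin.cons v x)

end Form

infixl:72 " ⋏ " => Form.wedge

/-- The 1-form dual to a vector. -/
def dual {n : ℕ} (v : EuclideanSpace ℝ (Fin n)) : Form n 1 := fun x => ⟪v, x 0⟫

abbrev E8 := EuclideanSpace ℝ (Fin 8)

/-- The basis vector `e`. -/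
def e8 : E8 := EuclideanSpace.single 7 1

/-- The basis vectors `e₀,…,e₆` indexed mod 7. -/
def u7 (i : ZMod 7) : E8 := EuclideanSpace.single ⟨i.val, i.val_lt.trans (by norm_num)⟩ 1

/-- The basis indexed by ℤ₈, with `e₇ = e`. -/
def u8 (i : ZMod 8) : E8 := EuclideanSpace.single ⟨i.val, i.val_lt⟩ 1

/-- The Spin(7) fundamental 4-form. -/
def Phi (σ : ℝ) : Form 8 4 := fun x =>
  (∑ i : ZMod 7, (dual e8 ⋏ dual (u7 i) ⋏ dual (u7 (i + 1)) ⋏ dual (u7 (i + 3))) x)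
    - σ * ∑ i : ZMod 7,
        (dual (u7 (i + 2)) ⋏ dual (u7 (i + 4)) ⋏ dual (u7 (i + 5)) ⋏ dual (u7 (i + 6))) x

/-- The standard volume form of ℝ⁸. -/
def vol8 : Form 8 8 :=
  dual e8 ⋏ dual (u7 0) ⋏ dual (u7 1) ⋏ dual (u7 2) ⋏ dual (u7 3) ⋏ dual (u7 4) ⋏ dual (u7 5)
    ⋏ dual (u7 6)

/-- The 2-forms spanning spin(7)ᗮ. -/
def beta (σ : ℝ) (i : ZMod 7) : Form 8 2 := fun x =>
  σ * (dual (u7 i) ⋏ dual e8) x + (dual (u7 (i + 1)) ⋏ dual (u7 (i + 3))) x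
    + (dual (u7 (i + 4)) ⋏ dual (u7 (i + 5))) x + (dual (u7 (i + 2)) ⋏ dual (u7 (i + 6))) x

namespace Form

/-- The decomposable `p`-form `v₀ ∧ ⋯ ∧ vₚ₋₁`, as a determinant of inner products. -/
def decomposable {n p : ℕ} (v : Fin p → EuclideanSpace ℝ (Fin n)) : Form n p :=
  fun x => (Matrix.of fun i j => ⟪v j, x i⟫).det

theorem dual_eq_decomposable {n : ℕ} (v : EuclideanSpace ℝ (Fin n)) :
    dual v = decomposable ![v] := by
  funext x
  simp [dual, decomposable]

theorem wedge_decomposable {n p q : ℕ} (v : Fin p → EuclideanSpace ℝ (Fin n))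
    (w : Fin q → EuclideanSpace ℝ (Fin n)) :
    decomposable v ⋏ decomposable w = decomposable (Fin.append v w) := by
  funext x
  have key (τ : Equiv.Perm (Fin p)) (ρ : Equiv.Perm (Fin q)) :
      ∑ σ : Equiv.Perm (Fin (p + q)), ((Equiv.Perm.sign σ : ℤ) : ℝ) *
        ((((Equiv.Perm.sign τ : ℤ) : ℝ) * ∏ i, ⟪v i, x (σ (Fin.castAdd q (τ i)))⟫) *
        (((Equiv.Perm.sign ρ : ℤ) : ℝ) * ∏ j, ⟪w j, x (σ (Fin.natAdd p (ρ j)))⟫)) =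
      decomposable (Fin.append v w) x := by
    rw [decomposable, Matrix.det_apply']
    refine Fintype.sum_equiv
      (Equiv.mulRight (finSumFinEquiv.permCongr (Equiv.Perm.sumCongr τ ρ))) _ _ fun σ => ?_
    simp [Fin.prod_univ_add, Equiv.permCongr_apply]
    ring
  simp only [wedge]
  rw [inv_mul_eq_iff_eq_mul₀ (by positivity)]
  calc _ = ∑ _τ : Equiv.Perm (Fin p), ∑ _ρ : Equiv.Perm (Fin q),
        decomposable (Fin.append v w) x := by
        rw [← Finset.sum_congr rfl fun τ _ => Finset.sum_congr rfl fun ρ _ => key τ ρ,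
          Finset.sum_congr rfl fun τ _ => Finset.sum_comm, Finset.sum_comm]
        refine Finset.sum_congr rfl fun σ _ => ?_
        simp only [decomposable, Matrix.det_apply', Matrix.of_apply, mul_assoc]
        rw [Finset.sum_mul_sum]
        simp only [Finset.mul_sum, mul_assoc]
    _ = _ := by simp [Fintype.card_perm, mul_assoc]

theorem dual_wedge_four {n : ℕ} (a b c d : EuclideanSpace ℝ (Fin n)) :
    dual a ⋏ dual b ⋏ dual c ⋏ dual d = decomposable ![a, b, c, d] := by
  simp only [dual_eq_decomposable, wedge_decomposable]
  congr 1
  funext i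
  fin_cases i <;> rfl

end Form

/-- The matrix of the bilinear form `Φ(a, b, ·, ·)`, in terms of the Plücker coordinates of
`a ∧ b`. -/
def phiMatrix (σ : ℝ) (a b : E8) : Matrix (Fin 8) (Fin 8) ℝ :=
  let p i j := a i * b j - a j * b i
  !![0, p 7 3 - σ * p 4 6 - σ * p 5 2,
      p 7 6 - σ * p 3 4 - σ * p 1 5, p 1 7 - σ * p 6 5 - σ * p 4 2,
      p 7 5 - σ * p 2 3 - σ * p 6 1, p 4 7 - σ * p 3 6 - σ * p 2 1,
      p 2 7 - σ * p 1 4 - σ * p 5 3, p 5 4 + p 6 2 + p 3 1;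
    p 3 7 - σ * p 2 5 - σ * p 6 4, 0,
      p 7 4 - σ * p 6 3 - σ * p 5 0, p 7 0 - σ * p 4 5 - σ * p 2 6,
      p 2 7 - σ * p 0 6 - σ * p 5 3, p 7 6 - σ * p 3 4 - σ * p 0 2,
      p 5 7 - σ * p 3 2 - σ * p 4 0, p 0 3 + p 6 5 + p 4 2;
    p 6 7 - σ * p 4 3 - σ * p 5 1, p 4 7 - σ * p 3 6 - σ * p 0 5,
      0, p 7 5 - σ * p 0 4 - σ * p 6 1,
      p 7 1 - σ * p 5 6 - σ * p 3 0, p 3 7 - σ * p 6 4 - σ * p 1 0,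
      p 7 0 - σ * p 4 5 - σ * p 1 3, p 1 4 + p 0 6 + p 5 3;
    p 7 1 - σ * p 5 6 - σ * p 2 4, p 0 7 - σ * p 5 4 - σ * p 6 2,
      p 5 7 - σ * p 1 6 - σ * p 4 0, 0,
      p 7 6 - σ * p 1 5 - σ * p 0 2, p 7 2 - σ * p 4 1 - σ * p 6 0,
      p 4 7 - σ * p 0 5 - σ * p 2 1, p 2 5 + p 6 4 + p 1 0;
    p 5 7 - σ * p 1 6 - σ * p 3 2, p 7 2 - σ * p 3 5 - σ * p 6 0,
      p 1 7 - σ * p 0 3 - σ * p 6 5, p 6 7 - σ * p 5 1 - σ * p 2 0,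
      0, p 7 0 - σ * p 2 6 - σ * p 1 3,
      p 7 3 - σ * p 0 1 - σ * p 5 2, p 3 6 + p 0 5 + p 2 1;
    p 7 4 - σ * p 1 2 - σ * p 6 3, p 6 7 - σ * p 4 3 - σ * p 2 0,
      p 7 3 - σ * p 4 6 - σ * p 0 1, p 2 7 - σ * p 1 4 - σ * p 0 6,
      p 0 7 - σ * p 6 2 - σ * p 3 1, 0,
      p 7 1 - σ * p 2 4 - σ * p 3 0, p 1 6 + p 3 2 + p 4 0;
    p 7 2 - σ * p 3 5 - σ * p 4 1, p 7 5 - σ * p 2 3 - σ * p 0 4,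
      p 0 7 - σ * p 5 4 - σ * p 3 1, p 7 4 - σ * p 1 2 - σ * p 5 0,
      p 3 7 - σ * p 2 5 - σ * p 1 0, p 1 7 - σ * p 0 3 - σ * p 4 2,
      0, p 4 3 + p 5 1 + p 2 0;
    p 4 5 + p 2 6 + p 1 3, p 5 6 + p 2 4 + p 3 0,
      p 3 5 + p 4 1 + p 6 0, p 4 6 + p 0 1 + p 5 2,
      p 1 2 + p 6 3 + p 5 0, p 2 3 + p 0 4 + p 6 1,
      p 3 4 + p 1 5 + p 0 2, 0]

theorem Phi_eq_dotProduct (σ : ℝ) (a b x y : E8) :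
    Phi σ ![a, b, x, y] = x.ofLp ⬝ᵥ (phiMatrix σ a b).mulVec y.ofLp := by
  have sum_zmod (f : ZMod 7 → ℝ) : ∑ i, f i = f 0 + f 1 + f 2 + f 3 + f 4 + f 5 + f 6 :=
    Fin.sum_univ_seven f
  let m (i j k l : Fin 8) : ℝ := Form.decomposable
    ![EuclideanSpace.single i 1, EuclideanSpace.single j 1, EuclideanSpace.single k 1,
      EuclideanSpace.single l 1] ![a, b, x, y]
  have m_eq (i j k l : Fin 8) : m i j k l =
      (a i * b j - a j * b i) * (x k * y l - x l * y k)
      - (a i * b k - a k * b i) * (x j * y l - x l * y j)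
      + (a i * b l - a l * b i) * (x j * y k - x k * y j)
      + (a j * b k - a k * b j) * (x i * y l - x l * y i)
      - (a j * b l - a l * b j) * (x i * y k - x k * y i)
      + (a k * b l - a l * b k) * (x i * y j - x j * y i) := by
    simp [m, Form.decomposable, Matrix.det_succ_row_zero, Fin.sum_univ_succ, Fin.succAbove,
      EuclideanSpace.inner_single_left]
    ring
  have Phi_eq : Phi σ ![a, b, x, y] =
      (m 7 0 1 3 + m 7 1 2 4 + m 7 2 3 5 + m 7 3 4 6
        + m 7 4 5 0 + m 7 5 6 1 + m 7 6 0 2)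
      - σ * (m 2 4 5 6 + m 3 5 6 0 + m 4 6 0 1 + m 5 0 1 2
        + m 6 1 2 3 + m 0 2 3 4 + m 1 3 4 5) := by
    simp only [Phi, Form.dual_wedge_four, sum_zmod]
    rfl
  rw [Phi_eq]
  simp only [m_eq]
  simp [phiMatrix, Matrix.mulVec, dotProduct, Fin.sum_univ_eight]
  ring

set_option maxHeartbeats 4000000 in
theorem phiMatrix_mul_self (σ : ℝ) (hσ : σ = 1 ∨ σ = -1) (a b : E8) :
    phiMatrix σ a b * phiMatrix σ a b = (⟪a, b⟫ ^ 2 - ⟪a, a⟫ * ⟪b, b⟫) • 1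
      + ⟪b, b⟫ • Matrix.vecMulVec a.ofLp a.ofLp + ⟪a, a⟫ • Matrix.vecMulVec b.ofLp b.ofLp
      - ⟪a, b⟫ • (Matrix.vecMulVec a.ofLp b.ofLp + Matrix.vecMulVec b.ofLp a.ofLp) := by
  have inner_eq (x y : E8) : ⟪x, y⟫ = x 0 * y 0 + x 1 * y 1 + x 2 * y 2 + x 3 * y 3 + x 4 * y 4
      + x 5 * y 5 + x 6 * y 6 + x 7 * y 7 := by
    simp [PiLp.inner_apply, Fin.sum_univ_eight, mul_comm]
  simp only [inner_eq]
  ext i j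
  fin_cases i <;> fin_cases j <;>
    simp [phiMatrix, Matrix.mul_apply, Fin.sum_univ_eight, Matrix.vecMulVec_apply] <;>
    rcases hσ with rfl | rfl <;> ring

set_option maxHeartbeats 1000000 in
theorem phiMatrix_transpose (σ : ℝ) (a b : E8) :
    (phiMatrix σ a b).transpose = -phiMatrix σ a b := by
  ext i j
  fin_cases i <;> fin_cases j <;> simp [phiMatrix] <;> ring

theorem phiMatrix_mulVec_left (σ : ℝ) (a b : E8) : (phiMatrix σ a b).mulVec a.ofLp = 0 := by
  ext i
  fin_cases i <;> simp [phiMatrix, Matrix.mulVec, dotProduct, Fin.sum_univ_eight] <;> ring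

theorem phiMatrix_mulVec_right (σ : ℝ) (a b : E8) : (phiMatrix σ a b).mulVec b.ofLp = 0 := by
  ext i
  fin_cases i <;> simp [phiMatrix, Matrix.mulVec, dotProduct, Fin.sum_univ_eight] <;> ring

/-- if `N₁,N₂` are orthonormal, `V = {x : ⟨x,N₁⟩ = ⟨x,N₂⟩ = 0}` and
`Jx = P(N₁,N₂,x)`, then `J` maps `V` to `V`, `J² = −1` on `V`, and `J` is orthogonal on `V`. -/
theorem stmt16 (σ : ℝ) (hσ : σ = 1 ∨ σ = -1)
    (P : E8 → E8 → E8 → E8) (hP : ∀ x y z w : E8, ⟪P x y z, w⟫ = Phi σ ![x, y, z, w])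
    (N₁ N₂ : E8) (hN₁ : ⟪N₁, N₁⟫ = 1) (hN₂ : ⟪N₂, N₂⟫ = 1) (hN₁₂ : ⟪N₁, N₂⟫ = 0) :
    (∀ x : E8, ⟪x, N₁⟫ = 0 → ⟪x, N₂⟫ = 0 →
      ⟪P N₁ N₂ x, N₁⟫ = 0 ∧ ⟪P N₁ N₂ x, N₂⟫ = 0) ∧
    (∀ x : E8, ⟪x, N₁⟫ = 0 → ⟪x, N₂⟫ = 0 → P N₁ N₂ (P N₁ N₂ x) = -x) ∧
    (∀ x y : E8, ⟪x, N₁⟫ = 0 → ⟪x, N₂⟫ = 0 → ⟪y, N₁⟫ = 0 → ⟪y, N₂⟫ = 0 →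
      ⟪P N₁ N₂ x, P N₁ N₂ y⟫ = ⟪x, y⟫) := by
  have inner_eq (x y : E8) : ⟪x, y⟫ = x.ofLp ⬝ᵥ y.ofLp := by
    simp [EuclideanSpace.inner_eq_star_dotProduct, dotProduct_comm]
  have inner_P (x w : E8) : ⟪P N₁ N₂ x, w⟫ = x.ofLp ⬝ᵥ (phiMatrix σ N₁ N₂).mulVec w.ofLp := by
    rw [hP, Phi_eq_dotProduct]
  have P_eq (x : E8) : (P N₁ N₂ x).ofLp = -(phiMatrix σ N₁ N₂).mulVec x.ofLp := by
    rw [← Matrix.neg_mulVec, ← phiMatrix_transpose, Matrix.mulVec_transpose]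
    refine dotProduct_eq _ _ fun w => ?_
    rw [← Matrix.dotProduct_mulVec]
    simpa [inner_eq] using inner_P x (WithLp.toLp 2 w)
  have P_P (x : E8) (h₁ : ⟪x, N₁⟫ = 0) (h₂ : ⟪x, N₂⟫ = 0) : P N₁ N₂ (P N₁ N₂ x) = -x := by
    have h₁' : N₁.ofLp ⬝ᵥ x.ofLp = 0 := by rw [← inner_eq, real_inner_comm, h₁]
    have h₂' : N₂.ofLp ⬝ᵥ x.ofLp = 0 := by rw [← inner_eq, real_inner_comm, h₂]
    apply WithLp.ofLp_injective
    rw [P_eq, P_eq, Matrix.mulVec_neg, neg_neg, Matrix.mulVec_mulVec, phiMatrix_mul_self σ hσ,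
      hN₁, hN₂, hN₁₂]
    simp [Matrix.add_mulVec, Matrix.neg_mulVec, Matrix.vecMulVec_mulVec, h₁', h₂']
  refine ⟨fun x _ _ => ?_, P_P, fun x y _ _ h₁ h₂ => ?_⟩
  · simp [inner_P, phiMatrix_mulVec_left, phiMatrix_mulVec_right]
  · rw [inner_P x, ← neg_neg ((phiMatrix σ N₁ N₂).mulVec _), ← P_eq, P_P y h₁ h₂]
    simp [inner_eq]
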